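/- Let α be a real number and suppose that the complex number β = e^{iα} is algebraic over ℚ. Then α/π is not an irrational algebraic number; that is, if α/π is algebraic over ℚ, then α/π is rational. -/

import Mathlib

open NumberField in
/-- Siegel's lemma over a number field, for systems with twice as many unknowns as equations. -/
theorem exists_house_le_of_card_eq_two_mul (K : Type*) [Field K] [NumberField K] :
    ∃ C : ℝ, ∀ (p : ℕ) (X : ℝ) {ι κ : Type} [Fintype ι] [Fintype κ] (a : Matrix ι κ (𝓞 K)),
      0 < p → Fintype.card ι = p → Fintype.card κ = 2 * p → a ≠ 0 →
      (∀ i k, house (a i k : K) ≤ X) →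
      ∃ ξ : κ → 𝓞 K, ξ ≠ 0 ∧ a.mulVec ξ = 0 ∧
        ∀ k, house (ξ k : K) ≤ C * (C * (2 * p) * X) := by
  classical
  have of_bound (c : ℝ) (h : ∀ (p q : ℕ) (X : ℝ) (ι κ : Type) [Fintype ι] [Fintype κ]
      (a : Matrix ι κ (𝓞 K)), 0 < p → p < q → Fintype.card ι = p → Fintype.card κ = q → a ≠ 0 →
      (∀ i k, house (algebraMap (𝓞 K) K (a i k)) ≤ X) →
      ∃ ξ : κ → 𝓞 K, ξ ≠ 0 ∧ a.mulVec ξ = 0 ∧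
        ∀ k, house (ξ k).1 ≤ c * (c * q * X) ^ ((p : ℝ) / (q - p))) :
      ∀ (p : ℕ) (X : ℝ) {ι κ : Type} [Fintype ι] [Fintype κ] (a : Matrix ι κ (𝓞 K)),
      0 < p → Fintype.card ι = p → Fintype.card κ = 2 * p → a ≠ 0 →
      (∀ i k, house (a i k : K) ≤ X) →
      ∃ ξ : κ → 𝓞 K, ξ ≠ 0 ∧ a.mulVec ξ = 0 ∧
        ∀ k, house (ξ k : K) ≤ c * (c * (2 * p) * X) := by
    intro p X ι κ _ _ a hp hι hκ ha hX
    obtain ⟨ξ, h0, h1, h2⟩ := h p (2 * p) X ι κ a hp (by lia) hι hκ ha hX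
    refine ⟨ξ, h0, h1, fun k ↦ (h2 k).trans_eq ?_⟩
    have hp' : (p : ℝ) ≠ 0 := by positivity
    have : (p : ℝ) / ((2 * p : ℕ) - p) = 1 := by
      push_cast
      rw [two_mul, add_sub_cancel_right, div_self hp']
    rw [this, Real.rpow_one]
    push_cast
    rfl
  exact ⟨_, of_bound _ fun p q X ι κ _ _ a hp hpq hι hκ ha hX ↦
    NumberField.house.exists_ne_zero_int_vec_house_le K a ha hp hpq hκ hX hι⟩

/-- An entire function vanishing on a finite set is divisible by the corresponding polynomial. -/
theorem exists_differentiable_eq_prod_mul (S : Finset ℂ) :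
    ∀ f : ℂ → ℂ, Differentiable ℂ f → (∀ s ∈ S, f s = 0) →
      ∃ g : ℂ → ℂ, Differentiable ℂ g ∧ ∀ z, f z = (∏ s ∈ S, (z - s)) * g z := by
  classical
  induction S using Finset.induction_on with
  | empty => exact fun f hf _ ↦ ⟨f, hf, by simp⟩
  | insert a S ha ih =>
    intro f hf h0
    have hd : Differentiable ℂ (dslope f a) := by
      rw [← differentiableOn_univ, Complex.differentiableOn_dslope Filter.univ_mem]
      exact hf.differentiableOn
    have hfa : ∀ z, f z = (z - a) * dslope f a z := fun z ↦ by
      have := sub_smul_dslope f a z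
      rw [h0 a (by simp), sub_zero, smul_eq_mul] at this
      exact this.symm
    obtain ⟨g, hg, hfg⟩ := ih _ hd fun s hs ↦ by
      have h1 := hfa s
      rw [h0 s (by simp [hs])] at h1
      exact (mul_eq_zero.1 h1.symm).resolve_left
        (sub_ne_zero.2 (ne_of_mem_of_not_mem hs ha))
    refine ⟨g, hg, fun z ↦ ?_⟩
    rw [hfa, hfg, Finset.prod_insert ha, mul_assoc]

/-- A Schwarz lemma for entire functions with many zeros in a disk. -/
theorem norm_le_div_two_pow_card {f : ℂ → ℂ} (hf : Differentiable ℂ f) {r Y : ℝ} (hr : 0 < r)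
    (S : Finset ℂ) (hS : ∀ s ∈ S, f s = 0) (hSr : ∀ s ∈ S, ‖s‖ ≤ r)
    (hY : ∀ z : ℂ, ‖z‖ = 5 * r → ‖f z‖ ≤ Y) {w : ℂ} (hw : ‖w‖ ≤ r) :
    ‖f w‖ ≤ Y / 2 ^ S.card := by
  obtain ⟨g, hg, hfg⟩ := exists_differentiable_eq_prod_mul S f hf hS
  have hgw : ‖g w‖ ≤ Y / (4 * r) ^ S.card := by
    refine Complex.norm_le_of_forall_mem_frontier_norm_le
      (U := Metric.ball 0 (5 * r)) Metric.isBounded_ball hg.diffContOnCl ?_ ?_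
    · intro z hz
      rw [frontier_ball _ (by positivity), mem_sphere_zero_iff_norm] at hz
      rw [le_div_iff₀ (by positivity)]
      calc ‖g z‖ * (4 * r) ^ S.card ≤ ‖g z‖ * ∏ s ∈ S, ‖z - s‖ := by
            gcongr
            rw [← Finset.prod_const]
            refine Finset.prod_le_prod (fun _ _ ↦ by positivity) fun s hs ↦ ?_
            have := norm_sub_norm_le z s
            have := hSr s hs
            linarith
        _ = ‖f z‖ := by rw [hfg, norm_mul, norm_prod, mul_comm]
        _ ≤ Y := hY z hz
    · apply subset_closure
      rw [mem_ball_zero_iff]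
      linarith
  calc ‖f w‖ = (∏ s ∈ S, ‖w - s‖) * ‖g w‖ := by rw [hfg, norm_mul, norm_prod]
    _ ≤ (2 * r) ^ S.card * (Y / (4 * r) ^ S.card) := by
        gcongr
        rw [← Finset.prod_const]
        refine Finset.prod_le_prod (fun _ _ ↦ by positivity) fun s hs ↦ ?_
        have := norm_sub_le w s
        have := hSr s hs
        linarith
    _ = Y / 2 ^ S.card := by
        rw [show 4 * r = 2 * (2 * r) by ring, mul_pow 2 (2 * r)]
        field_simp

/-- The growth comparison behind the choice of parameters. -/
theorem exists_forall_pow_lt_two_pow_sq {C : ℝ} (hC : 1 ≤ C) (d : ℕ) :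
    ∃ u : ℕ, 0 < u ∧ ∀ M : ℕ, u ^ 2 ≤ M →
      ((C * M) ^ (10 * u ^ 3) * C ^ (2 * u * M)) ^ d < (2 : ℝ) ^ (M ^ 2) := by
  have hC0 : 0 ≤ Real.log C := Real.log_nonneg hC
  have h1 : ∀ᶠ x : ℝ in Filter.atTop, (12 * Real.log C + 10 * Real.log x) * (2 * d) ≤ √x := by
    have h2 : (fun x : ℝ ↦ (12 * Real.log C + 10 * Real.log x) * (2 * d)) =o[Filter.atTop]
        fun x ↦ x ^ (1 / 2 : ℝ) := by
      have hl := isLittleO_log_rpow_atTop (show (0 : ℝ) < 1 / 2 by norm_num)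
      have hc : (fun _ : ℝ ↦ 12 * Real.log C) =o[Filter.atTop] fun x ↦ x ^ (1 / 2 : ℝ) :=
        Asymptotics.isLittleO_const_left.2 <| Or.inr <|
          tendsto_norm_atTop_atTop.comp (tendsto_rpow_atTop (by norm_num))
      have := (hc.add (hl.const_mul_left 10)).const_mul_left (2 * d)
      simpa only [mul_comm] using this
    filter_upwards [h2.def one_pos, Filter.eventually_ge_atTop 0] with x hx hx0
    rw [Real.sqrt_eq_rpow]
    rw [one_mul, Real.norm_of_nonneg (by positivity : 0 ≤ x ^ (1 / 2 : ℝ))] at hx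
    exact (le_abs_self _).trans hx
  obtain ⟨u₀, hu₀⟩ := Filter.eventually_atTop.1 (tendsto_natCast_atTop_atTop.eventually h1)
  refine ⟨u₀ + 1, by lia, fun M hM ↦ ?_⟩
  set u := u₀ + 1
  have huu : u ≤ u ^ 2 := Nat.le_self_pow two_ne_zero u
  have hMu : u₀ ≤ M := by lia
  have hM1 : 1 ≤ M := by lia
  have hM1' : (1 : ℝ) ≤ M := by exact_mod_cast hM1
  have hM2 : (u : ℝ) ^ 2 ≤ M := by exact_mod_cast hM
  have hus : (u : ℝ) ≤ √M := Real.le_sqrt_of_sq_le hM2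
  have hlogM : 0 ≤ Real.log M := Real.log_nonneg hM1'
  have key := hu₀ M hMu
  rw [← Real.log_lt_log_iff (by positivity) (by positivity), Real.log_pow, Real.log_mul
    (by positivity) (by positivity), Real.log_pow, Real.log_pow, Real.log_pow, Real.log_mul
    (by positivity) (by positivity)]
  push_cast
  have hu3 : (u : ℝ) ^ 3 ≤ u * M := by nlinarith [(Nat.cast_nonneg u : (0 : ℝ) ≤ u)]
  have hss : √(M : ℝ) * √M = M := Real.mul_self_sqrt (by positivity)
  calc (d : ℝ) * (10 * u ^ 3 * (Real.log C + Real.log M) + 2 * u * M * Real.log C)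
      ≤ d * (10 * (u * M) * (Real.log C + Real.log M) + 2 * u * M * Real.log C) := by gcongr
    _ = u * M / 2 * ((12 * Real.log C + 10 * Real.log M) * (2 * d)) := by ring
    _ ≤ √M * M / 2 * √M := by gcongr
    _ = (M : ℝ) ^ 2 * (1 / 2) := by linear_combination (M / 2 : ℝ) * hss
    _ < (M : ℝ) ^ 2 * Real.log 2 := by
        gcongr
        linarith [Real.log_two_gt_d9]

/-- The value of `(D * z) ^ j * exp (2 * π * I * k * z)` at the point `m + n * b`, multiplied by
`D ^ T`, where `x = D * b` and `y = D * exp (2 * π * I * b)`. -/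
def scaledValue {R : Type*} [CommRing R] (D : ℕ) (x y : R) (T m n j k : ℕ) : R :=
  (D * m + n * x) ^ j * (y ^ (k * n) * (D : R) ^ (T - k * n))

/-- The exponential polynomial with coefficients `c`, in the functions
`(D * z) ^ j * exp (2 * π * I * k * z)`. -/
noncomputable def expPoly {A B : ℕ} (D : ℕ) (c : Fin A × Fin B → ℂ) (z : ℂ) : ℂ :=
  ∑ p, c p * ((D * z) ^ (p.1 : ℕ) * Complex.exp (2 * Real.pi * Complex.I * (p.2 : ℕ) * z))

theorem differentiable_expPoly {A B : ℕ} (D : ℕ) (c : Fin A × Fin B → ℂ) :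
    Differentiable ℂ (expPoly D c) := by
  unfold expPoly
  fun_prop

theorem expPoly_add_mul {A B : ℕ} (D : ℕ) (c : Fin A × Fin B → ℂ) (b : ℂ) (m n : ℕ) :
    expPoly D c (m + n * b) = ∑ p, c p * ((D * (m + n * b)) ^ (p.1 : ℕ) *
      (Complex.exp (2 * Real.pi * Complex.I * b) ^ n) ^ (p.2 : ℕ)) := by
  unfold expPoly
  refine Finset.sum_congr rfl fun p _ ↦ ?_
  have : Complex.exp (2 * Real.pi * Complex.I * (p.2 : ℕ) * (m + n * b)) =
      (Complex.exp (2 * Real.pi * Complex.I * b) ^ n) ^ (p.2 : ℕ) := by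
    rw [← pow_mul, ← Complex.exp_nat_mul, Complex.exp_eq_exp_iff_exists_int]
    exact ⟨p.2 * m, by push_cast; ring⟩
  rw [this]

theorem pow_mul_expPoly_add_mul {K : Type*} [Field K] {A B : ℕ} {D : ℕ} {x y : K} {b : ℂ}
    (σ : K →+* ℂ) (hx : σ x = D * b)
    (hy : σ y = D * Complex.exp (2 * Real.pi * Complex.I * b)) (c : Fin A × Fin B → K)
    {T m n : ℕ} (hT : B * n ≤ T) :
    (D : ℂ) ^ T * expPoly D (fun p ↦ σ (c p)) (m + n * b) =
      σ (∑ p, c p * scaledValue D x y T m n p.1 p.2) := by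
  rw [expPoly_add_mul, Finset.mul_sum, map_sum]
  refine Finset.sum_congr rfl fun p _ ↦ ?_
  have hle : (p.2 : ℕ) * n ≤ T := (Nat.mul_le_mul_right n p.2.2.le).trans hT
  obtain ⟨t, rfl⟩ := Nat.exists_eq_add_of_le hle
  simp only [scaledValue, map_mul, map_pow, map_add, map_natCast, hx, hy, add_tsub_cancel_left]
  rw [show (D : ℂ) * m + n * (D * b) = D * (m + n * b) by ring, pow_add,
    mul_pow (D : ℂ) (Complex.exp _), ← pow_mul, mul_comm n]
  ring

theorem norm_expPoly_le {A B : ℕ} {D : ℕ} {c : Fin A × Fin B → ℂ} {H R : ℝ}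
    (hc : ∀ p, ‖c p‖ ≤ H) (hR : 1 ≤ D * R) {z : ℂ} (hz : ‖z‖ = R) :
    ‖expPoly D c z‖ ≤ A * B * H * ((D * R) ^ A * Real.exp (2 * Real.pi * R) ^ B) := by
  have hR0 : 0 ≤ R := hz ▸ norm_nonneg z
  have hterm : ∀ p : Fin A × Fin B, ‖c p * ((D * z) ^ (p.1 : ℕ) *
      Complex.exp (2 * Real.pi * Complex.I * (p.2 : ℕ) * z))‖ ≤
      H * ((D * R) ^ A * Real.exp (2 * Real.pi * R) ^ B) := fun p ↦ by
    have hH : 0 ≤ H := (norm_nonneg _).trans (hc p)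
    rw [norm_mul, norm_mul, norm_pow, norm_mul, Complex.norm_natCast, hz]
    gcongr
    · exact hc p
    · exact p.1.2.le
    · calc ‖Complex.exp (2 * Real.pi * Complex.I * (p.2 : ℕ) * z)‖
          ≤ Real.exp ‖2 * Real.pi * Complex.I * (p.2 : ℕ) * z‖ := Complex.norm_exp_le_exp_norm _
        _ = Real.exp (2 * Real.pi * R) ^ (p.2 : ℕ) := by
          rw [← Real.exp_nat_mul]
          congr 1
          simp [hz, abs_of_pos Real.pi_pos]
          ring
        _ ≤ Real.exp (2 * Real.pi * R) ^ B := by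
          gcongr
          · exact Real.one_le_exp (by positivity)
          · exact p.2.2.le
  calc _ ≤ ∑ p : Fin A × Fin B, H * ((D * R) ^ A * Real.exp (2 * Real.pi * R) ^ B) :=
        norm_sum_le_of_le _ fun p _ ↦ hterm p
    _ = _ := by simp; ring

/-- `exp (2 * π * I * b)` is not a root of unity when `b` is irrational. -/
theorem injective_exp_pow {b : ℂ} (hb : ∀ r : ℚ, b ≠ r) :
    Function.Injective fun n : ℕ ↦ Complex.exp (2 * Real.pi * Complex.I * b) ^ n := by
  intro m n hmn
  simp only [← Complex.exp_nat_mul] at hmn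
  obtain ⟨l, hl⟩ := Complex.exp_eq_exp_iff_exists_int.1 hmn
  by_contra hne
  have h0 : (m : ℂ) - n ≠ 0 := sub_ne_zero.2 (by exact_mod_cast hne)
  have h1 : ((m : ℂ) - n) * b = l := by
    apply mul_left_cancel₀ Complex.two_pi_I_ne_zero
    linear_combination hl
  refine hb (l / (m - n)) ?_
  push_cast
  rw [eq_div_iff h0, mul_comm, h1]

/-- An exponential polynomial vanishing at all points `m + n * b` is trivial. -/
theorem eq_zero_of_expPoly_eq_zero {A B D : ℕ} (hD : D ≠ 0) {b : ℂ} (hb : ∀ r : ℚ, b ≠ r)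
    {c : Fin A × Fin B → ℂ} (h : ∀ m n : ℕ, expPoly D c (m + n * b) = 0) : c = 0 := by
  have eq_zero_of_sum {N : ℕ} (a : Fin N → ℂ) (s : ℕ → ℂ) (hs : Function.Injective s)
      (ha : ∀ i, ∑ j, a j * s i ^ (j : ℕ) = 0) : a = 0 := by
    have hv : (Matrix.vandermonde fun i : Fin N ↦ s i).det ≠ 0 :=
      Matrix.det_vandermonde_ne_zero_iff.2 (hs.comp Fin.val_injective)
    refine Matrix.eq_zero_of_mulVec_eq_zero hv (funext fun i ↦ ?_)
    simpa [Matrix.mulVec, dotProduct, Matrix.vandermonde_apply, mul_comm] using ha i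
  have hrow : ∀ (n : ℕ) (j : Fin A),
      ∑ k, c (j, k) * (Complex.exp (2 * Real.pi * Complex.I * b) ^ n) ^ (k : ℕ) = 0 := by
    intro n
    refine congrFun (eq_zero_of_sum _ (fun m : ℕ ↦ (D : ℂ) * (m + n * b)) ?_ fun m ↦ ?_)
    · intro m m' hm
      simpa [hD] using hm
    · rw [← h m n, expPoly_add_mul, Fintype.sum_prod_type]
      refine Finset.sum_congr rfl fun j _ ↦ ?_
      rw [Finset.sum_mul]
      exact Finset.sum_congr rfl fun k _ ↦ by ring
  ext ⟨j, k⟩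
  exact congrFun (eq_zero_of_sum (fun k ↦ c (j, k)) _ (injective_exp_pow hb)
    fun n ↦ hrow n j) k

open NumberField in
theorem house_scaledValue_le {K : Type*} [Field K] [NumberField K] {D : ℕ} {x y : K} {C : ℝ}
    (hC : 1 ≤ C) (hx : D + house x ≤ C) (hy : house y ≤ C) {A T M m n j k : ℕ} (hM : 1 ≤ M)
    (hm : m ≤ M) (hn : n ≤ M) (hj : j ≤ A) (hT : k * n ≤ T) :
    house (scaledValue D x y T m n j k) ≤ (C * M) ^ A * C ^ T := by
  have hM1 : (1 : ℝ) ≤ M := by exact_mod_cast hM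
  rw [house, pi_norm_le_iff_of_nonneg (by positivity)]
  intro σ
  have hxσ : ‖σ x‖ ≤ house x := norm_embedding_le_house x σ
  have hyσ : ‖σ y‖ ≤ C := (norm_embedding_le_house y σ).trans hy
  have hD : (D : ℝ) ≤ C := by linarith [house_nonneg x]
  have h1 : ‖(D : ℂ) * m + n * σ x‖ ≤ C * M := by
    calc ‖(D : ℂ) * m + n * σ x‖ ≤ D * m + n * ‖σ x‖ := by
          refine (norm_add_le _ _).trans_eq ?_
          simp
      _ ≤ D * M + M * house x := by gcongr
      _ = (D + house x) * M := by ring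
      _ ≤ C * M := by gcongr
  have hCM : 1 ≤ C * M := one_le_mul_of_one_le_of_one_le hC hM1
  simp only [canonicalEmbedding.apply_at, scaledValue, map_mul, map_pow, map_add, map_natCast,
    norm_mul, norm_pow, Complex.norm_natCast]
  calc _ ≤ (C * M) ^ j * (C ^ (k * n) * C ^ (T - k * n)) := by gcongr
    _ = (C * M) ^ j * C ^ T := by rw [← pow_add, Nat.add_sub_cancel' hT]
    _ ≤ _ := by gcongr

theorem siegel_bound_le {C : ℝ} (hC : 1 ≤ C) {u M : ℕ} (hu : 0 < u) (hM : u ^ 2 ≤ M) :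
    (2 * u ^ 3 : ℕ) * u * (C * (C * (2 * (u ^ 4 : ℕ)) * ((C * (u ^ 2 : ℕ)) ^ (2 * u ^ 3) *
      C ^ (u * u ^ 2)))) * ((C * M) ^ (2 * u ^ 3) * C ^ (u * M)) ≤
    (2 * C * M) ^ (10 * u ^ 3) * (2 * C) ^ (2 * u * M) := by
  have hM1 : (1 : ℝ) ≤ M := by
    exact_mod_cast (Nat.one_le_pow 2 u hu).trans hM
  have hM2 : ((u ^ 2 : ℕ) : ℝ) ≤ M := by exact_mod_cast hM
  set Z := 2 * C * M with hZ
  have hCZ : C ≤ Z := by nlinarith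
  have hZ1 : 1 ≤ Z := hC.trans hCZ
  have hCM : C * M ≤ Z := by nlinarith
  have h4 : (2 : ℝ) * (u ^ 4 : ℕ) ≤ Z ^ 2 := by
    have : ((u ^ 4 : ℕ) : ℝ) ≤ M ^ 2 := by
      calc ((u ^ 4 : ℕ) : ℝ) = ((u ^ 2 : ℕ) : ℝ) ^ 2 := by push_cast; ring
        _ ≤ _ := by gcongr
    have hC2 : 1 ≤ C ^ 2 := one_le_pow₀ hC
    rw [hZ, mul_pow]
    nlinarith
  have hAB : ((2 * u ^ 3 : ℕ) : ℝ) * u ≤ Z ^ 2 := by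
    refine le_of_eq_of_le ?_ h4
    push_cast
    ring
  calc _ ≤ Z ^ 2 * (Z * (Z * Z ^ 2 * (Z ^ (2 * u ^ 3) * (2 * C) ^ (u * M)))) *
          (Z ^ (2 * u ^ 3) * (2 * C) ^ (u * M)) := by
        have hCu : C * (u ^ 2 : ℕ) ≤ Z := by
          refine le_trans ?_ hCM
          gcongr
        have hpow : C ^ (u * u ^ 2) ≤ (2 * C) ^ (u * M) := by
          calc C ^ (u * u ^ 2) ≤ C ^ (u * M) := by gcongr
            _ ≤ _ := by gcongr; linarith
        gcongr
        linarith
    _ = Z ^ (6 + 4 * u ^ 3) * (2 * C) ^ (2 * u * M) := by ring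
    _ ≤ _ := by
        have : 1 ≤ u ^ 3 := Nat.one_le_pow 3 u hu
        gcongr
        lia

open NumberField in
theorem eq_zero_of_house_le {K : Type*} [Field K] [NumberField K] (σ : K →+* ℂ) {s : 𝓞 K}
    {Y X : ℝ} (hs : house (s : K) ≤ Y) (hσ : ‖σ s‖ ≤ Y / X) (hX : 0 < X)
    (hY : Y ^ Module.finrank ℚ K < X) : s = 0 := by
  by_contra h0
  have hN : (1 : ℝ) ≤ ‖Algebra.norm ℚ (s : K)‖ := by
    have h1 : Algebra.norm ℤ s ≠ 0 := Algebra.norm_ne_zero_iff.2 h0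
    rw [← Algebra.coe_norm_int s, ← Rat.norm_cast_real, Rat.cast_intCast, Real.norm_eq_abs]
    exact_mod_cast Int.one_le_abs h1
  have hY0 : 0 ≤ Y := (house_nonneg _).trans hs
  have hle : ‖Algebra.norm ℚ (s : K)‖ ≤ Y / X * Y ^ (Module.finrank ℚ K - 1) :=
    (norm_norm_le_norm_mul_house_pow _ σ).trans <| by
      have := house_nonneg (s : K)
      gcongr
  have hpos : 0 < Module.finrank ℚ K := Module.finrank_pos
  rw [div_mul_eq_mul_div, ← pow_succ', Nat.sub_add_cancel hpos] at hle
  exact absurd (hN.trans hle) (not_le.2 ((div_lt_one hX).2 hY))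

/-- The points `m + n * b` with `m, n < M`. -/
noncomputable def latticePoints (b : ℂ) (M : ℕ) : Finset ℂ :=
  (Finset.range M ×ˢ Finset.range M).image fun p ↦ (p.1 + p.2 * b : ℂ)

theorem card_latticePoints {b : ℂ} (hb : ∀ r : ℚ, b ≠ r) (M : ℕ) :
    (latticePoints b M).card = M ^ 2 := by
  rw [latticePoints, Finset.card_image_of_injective, Finset.card_product, Finset.card_range, sq]
  rintro ⟨m, n⟩ ⟨m', n'⟩ h
  simp only at h
  have hn : n = n' := by
    by_contra hne
    have h0 : (n : ℂ) - n' ≠ 0 := sub_ne_zero.2 (by exact_mod_cast hne)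
    refine hb ((m' - m) / (n - n')) ?_
    push_cast
    rw [eq_div_iff h0]
    linear_combination h
  subst hn
  simpa using h

theorem norm_add_mul_le {b : ℂ} {M m n : ℕ} (hm : m ≤ M) (hn : n ≤ M) :
    ‖(m + n * b : ℂ)‖ ≤ (1 + ‖b‖) * M := by
  calc ‖(m + n * b : ℂ)‖ ≤ m + n * ‖b‖ := (norm_add_le _ _).trans_eq (by simp)
    _ ≤ M + M * ‖b‖ := by gcongr
    _ = _ := by ring

open NumberField in
/-- The number field form of the theorem of Gelfond and Schneider for powers of `-1`: the numbers
`b` and `exp (2 * π * I * b)` cannot both be algebraic if `b` is irrational. -/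
theorem exists_rat_eq_of_mem_numberField {K : Type*} [Field K] [NumberField K] (σ : K →+* ℂ)
    {D : ℕ} (hD : D ≠ 0) {x y : 𝓞 K} {b : ℂ} (hx : σ x = D * b)
    (hy : σ y = D * Complex.exp (2 * Real.pi * Complex.I * b)) : ∃ r : ℚ, b = r := by
  by_contra! hb
  obtain ⟨C₀, hC₀⟩ := exists_house_le_of_card_eq_two_mul K
  have hD1 : (1 : ℝ) ≤ D := by exact_mod_cast Nat.one_le_iff_ne_zero.2 hD
  set ρ := 1 + ‖b‖ with hρ
  have hρ1 : 1 ≤ ρ := by simp [hρ]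
  obtain ⟨C, hC1, hCC₀, hCx, hCy, hCρ, hCe⟩ : ∃ C : ℝ, 1 ≤ C ∧ |C₀| ≤ C ∧ D + house (x : K) ≤ C ∧
      house (y : K) ≤ C ∧ D * (5 * ρ) ≤ C ∧ D * Real.exp (2 * Real.pi * (5 * ρ)) ≤ C := by
    refine ⟨1 + |C₀| + (D + house (x : K)) + house (y : K) + D * (5 * ρ) +
      D * Real.exp (2 * Real.pi * (5 * ρ)), ?_⟩
    have h1 := abs_nonneg C₀
    have h2 := house_nonneg (x : K)
    have h3 := house_nonneg (y : K)
    have h4 : 0 ≤ D * (5 * ρ) := by positivity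
    have h5 : 0 ≤ D * Real.exp (2 * Real.pi * (5 * ρ)) := by positivity
    refine ⟨?_, ?_, ?_, ?_, ?_, ?_⟩ <;> linarith
  obtain ⟨u, hu, hgrowth⟩ := exists_forall_pow_lt_two_pow_sq (C := 2 * C) (by linarith)
    (Module.finrank ℚ K)
  have coe_scaledValue : ∀ T m n j k, ((scaledValue D x y T m n j k : 𝓞 K) : K) =
      scaledValue D (x : K) (y : K) T m n j k := fun T m n j k ↦ by simp [scaledValue]
  have hu2 : 1 ≤ u ^ 2 := Nat.one_le_pow 2 u hu
  have hval : ∀ M m n, u ^ 2 ≤ M → m ≤ M → n ≤ M → ∀ p : Fin (2 * u ^ 3) × Fin u,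
      house ((scaledValue D x y (u * M) m n p.1 p.2 : 𝓞 K) : K) ≤
        (C * M) ^ (2 * u ^ 3) * C ^ (u * M) := fun M m n hM hm hn p ↦ by
    rw [coe_scaledValue]
    exact house_scaledValue_le hC1 hCx hCy (hu2.trans hM) hm hn p.1.2.le
      (Nat.mul_le_mul p.2.2.le hn)
  obtain ⟨ξ, hξ0, hξ, hξH⟩ := hC₀ (u ^ 4) ((C * (u ^ 2 : ℕ)) ^ (2 * u ^ 3) * C ^ (u * u ^ 2))
    (Matrix.of fun (i : Fin (u ^ 2) × Fin (u ^ 2)) (p : Fin (2 * u ^ 3) × Fin u) ↦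
      (scaledValue D x y (u * u ^ 2) i.1 i.2 p.1 p.2 : 𝓞 K))
    (by positivity) (by simp; ring) (by simp; ring)
    (fun h ↦ by
      have := congrFun₂ h (⟨0, hu2⟩, ⟨0, hu2⟩) (⟨0, by positivity⟩, ⟨0, hu⟩)
      simp [scaledValue, hD] at this)
    (fun i p ↦ hval _ _ _ le_rfl i.1.2.le i.2.2.le p)
  set H := C * (C * (2 * (u ^ 4 : ℕ)) * ((C * (u ^ 2 : ℕ)) ^ (2 * u ^ 3) * C ^ (u * u ^ 2)))
    with hH
  have hξH' : ∀ p, house (ξ p : K) ≤ H := fun p ↦ by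
    refine (hξH p).trans ?_
    calc C₀ * (C₀ * (2 * (u ^ 4 : ℕ)) * ((C * (u ^ 2 : ℕ)) ^ (2 * u ^ 3) * C ^ (u * u ^ 2)))
        = |C₀| * (|C₀| * (2 * (u ^ 4 : ℕ)) *
          ((C * (u ^ 2 : ℕ)) ^ (2 * u ^ 3) * C ^ (u * u ^ 2))) := by
          linear_combination (-(2 * (u ^ 4 : ℕ)) *
            ((C * (u ^ 2 : ℕ)) ^ (2 * u ^ 3) * C ^ (u * u ^ 2))) * abs_mul_abs_self C₀
      _ ≤ H := by rw [hH]; gcongr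
  have hH0 : 0 ≤ H := by positivity
  set F := expPoly D fun p ↦ σ (ξ p) with hF
  let s : ℕ → ℕ → ℕ → 𝓞 K := fun M m n ↦ ∑ p, ξ p * scaledValue D x y (u * M) m n p.1 p.2
  have hFs : ∀ M m n : ℕ, n ≤ M → (D : ℂ) ^ (u * M) * F (m + n * b) = σ (s M m n) := by
    intro M m n hn
    rw [hF, pow_mul_expPoly_add_mul σ hx hy _ (Nat.mul_le_mul_left u hn)]
    simp only [s, map_sum, map_mul, coe_scaledValue]
  have hDT : ∀ T : ℕ, (D : ℂ) ^ T ≠ 0 := fun T ↦ pow_ne_zero _ (by exact_mod_cast hD)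
  have step : ∀ M, u ^ 2 ≤ M → (∀ m n, m < M → n < M → F (m + n * b) = 0) →
      ∀ m n, m ≤ M → n ≤ M → F (m + n * b) = 0 := by
    intro M hM hzero m n hm hn
    have hM1 : (1 : ℝ) ≤ M := by exact_mod_cast hu2.trans hM
    set Y := (2 * u ^ 3 : ℕ) * u * H * ((C * M) ^ (2 * u ^ 3) * C ^ (u * M)) with hY
    have hYle : Y ≤ (2 * C * M) ^ (10 * u ^ 3) * (2 * C) ^ (2 * u * M) :=
      siegel_bound_le hC1 hu hM
    have hY0 : 0 ≤ Y := by positivity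
    have hs0 : s M m n = 0 := by
      refine eq_zero_of_house_le σ (Y := Y) (X := 2 ^ (M ^ 2)) ?_ ?_ (by positivity) ?_
      · simp only [s, map_sum, map_mul]
        refine (house_sum_le_sum_house _ _).trans ?_
        calc _ ≤ ∑ p : Fin (2 * u ^ 3) × Fin u, H * ((C * M) ^ (2 * u ^ 3) * C ^ (u * M)) := by
              refine Finset.sum_le_sum fun p _ ↦ (house_mul_le _ _).trans ?_
              exact mul_le_mul (hξH' p) (hval M m n hM hm hn p) (house_nonneg _) hH0
          _ = Y := by simp [hY]; ring
      · have hFw : ‖F (m + n * b)‖ ≤ ((2 * u ^ 3 : ℕ) * u * H * ((D * (5 * (ρ * M))) ^ (2 * u ^ 3) *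
            Real.exp (2 * Real.pi * (5 * (ρ * M))) ^ u)) / 2 ^ (M ^ 2) := by
          rw [← card_latticePoints hb M]
          refine norm_le_div_two_pow_card (differentiable_expPoly D _) (r := ρ * M) (by positivity)
            _ ?_ ?_ ?_ (norm_add_mul_le hm hn)
          · simp only [latticePoints, Finset.mem_image, Finset.mem_product, Finset.mem_range]
            rintro _ ⟨⟨m', n'⟩, ⟨h1, h2⟩, rfl⟩
            exact hzero m' n' h1 h2
          · simp only [latticePoints, Finset.mem_image, Finset.mem_product, Finset.mem_range]
            rintro _ ⟨⟨m', n'⟩, ⟨h1, h2⟩, rfl⟩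
            exact norm_add_mul_le h1.le h2.le
          · intro z hz
            refine norm_expPoly_le (fun p ↦ (norm_embedding_le_house _ σ).trans (hξH' p)) ?_ hz
            have : 1 ≤ ρ * M := one_le_mul_of_one_le_of_one_le hρ1 hM1
            exact one_le_mul_of_one_le_of_one_le hD1 (by linarith)
        rw [← hFs M m n hn, norm_mul, norm_pow, Complex.norm_natCast]
        calc _ ≤ (D : ℝ) ^ (u * M) * (((2 * u ^ 3 : ℕ) * u * H *
              ((D * (5 * (ρ * M))) ^ (2 * u ^ 3) *
              Real.exp (2 * Real.pi * (5 * (ρ * M))) ^ u)) / 2 ^ (M ^ 2)) := by gcongr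
          _ = ((2 * u ^ 3 : ℕ) * u * H * ((D * (5 * ρ) * M) ^ (2 * u ^ 3) *
              (D * Real.exp (2 * Real.pi * (5 * ρ))) ^ (u * M))) / 2 ^ (M ^ 2) := by
            have : Real.exp (2 * Real.pi * (5 * (ρ * M))) ^ u =
                Real.exp (2 * Real.pi * (5 * ρ)) ^ (u * M) := by
              rw [← Real.exp_nat_mul, ← Real.exp_nat_mul]
              congr 1
              push_cast
              ring
            rw [this, mul_pow (D : ℝ) (Real.exp _), ← mul_assoc 5 ρ, ← mul_assoc (D : ℝ)]
            ring
          _ ≤ Y / 2 ^ (M ^ 2) := by rw [hY]; gcongr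
      · exact (pow_le_pow_left₀ hY0 hYle _).trans_lt (hgrowth M hM)
    have h1 := hFs M m n hn
    rw [hs0] at h1
    simpa [hDT] using h1
  have hall : ∀ M, u ^ 2 ≤ M → ∀ m n, m < M → n < M → F (m + n * b) = 0 := by
    intro M hM
    induction M, hM using Nat.le_induction with
    | base =>
      intro m n hm hn
      have h1 := hFs (u ^ 2) m n hn.le
      have h2 : s (u ^ 2) m n = 0 := by
        have := congrFun hξ (⟨m, hm⟩, ⟨n, hn⟩)
        simp only [Matrix.mulVec, dotProduct, Matrix.of_apply, Pi.zero_apply] at this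
        rw [← this]
        exact Finset.sum_congr rfl fun p _ ↦ mul_comm _ _
      rw [h2] at h1
      simpa [hDT] using h1
    | succ M hM ih =>
      exact fun m n hm hn ↦ step M hM ih m n (Nat.lt_succ_iff.1 hm) (Nat.lt_succ_iff.1 hn)
  apply hξ0
  have hc := eq_zero_of_expPoly_eq_zero hD hb fun m n ↦
    hall (u ^ 2 + m + n + 1) (by lia) m n (by lia) (by lia)
  ext p
  simpa using congrFun hc p

/-- If `b` and `exp (2 * π * I * b)` are algebraic, then `b` is rational. -/
theorem exists_rat_eq_of_isAlgebraic_exp {b : ℂ} (hb : IsAlgebraic ℚ b)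
    (hq : IsAlgebraic ℚ (Complex.exp (2 * Real.pi * Complex.I * b))) : ∃ r : ℚ, b = r := by
  set q := Complex.exp (2 * Real.pi * Complex.I * b) with hqdef
  let K := IntermediateField.adjoin ℚ ({b, q} : Set ℂ)
  have hfin : FiniteDimensional ℚ K := by
    refine IntermediateField.finiteDimensional_adjoin fun z hz ↦ ?_
    rcases hz with rfl | rfl
    exacts [hb.isIntegral, hq.isIntegral]
  have : NumberField K := ⟨⟩
  have exists_multiple (z : K) : ∃ d : ℤ, d ≠ 0 ∧ IsIntegral ℤ (d • z) := by
    have hz : IsAlgebraic ℤ z :=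
      (IsFractionRing.isAlgebraic_iff ℤ ℚ K).2 (Algebra.IsAlgebraic.isAlgebraic z)
    exact hz.exists_integral_multiple
  let b' : K := ⟨b, IntermediateField.subset_adjoin _ _ (by simp)⟩
  let q' : K := ⟨q, IntermediateField.subset_adjoin _ _ (by simp)⟩
  obtain ⟨d, hd, hdb⟩ := exists_multiple b'
  obtain ⟨e, he, heq⟩ := exists_multiple q'
  have hcast : (((d * e) ^ 2).toNat : ℤ) = (d * e) ^ 2 := Int.toNat_of_nonneg (by positivity)
  have hcast' : (((d * e) ^ 2).toNat : ℂ) = ((d : ℂ) * e) ^ 2 := by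
    exact_mod_cast congrArg (Int.cast (R := ℂ)) hcast
  refine exists_rat_eq_of_mem_numberField (algebraMap K ℂ) (D := ((d * e) ^ 2).toNat) ?_
    (x := ⟨(d * e ^ 2) • d • b', hdb.smul _⟩) (y := ⟨(d ^ 2 * e) • e • q', heq.smul _⟩) ?_ ?_
  · have : 0 < (d * e) ^ 2 := by positivity
    lia
  · rw [hcast']
    change algebraMap K ℂ ((d * e ^ 2) • d • b') = _
    rw [map_zsmul, map_zsmul]
    change (d * e ^ 2) • d • b = _
    simp only [zsmul_eq_mul]
    push_cast
    ring
  · rw [hcast']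
    change algebraMap K ℂ ((d ^ 2 * e) • e • q') = _
    rw [map_zsmul, map_zsmul]
    change (d ^ 2 * e) • e • q = _
    simp only [zsmul_eq_mul]
    push_cast
    ring

/-- If `α` is real and `β = e^{iα}` is algebraic over `ℚ`, then `α/π` cannot be an
irrational algebraic number: if `α/π` is algebraic over `ℚ`, then it is rational. -/
theorem stmt_5 (α : ℝ) (halg : IsAlgebraic ℚ (Complex.exp (Complex.I * α)))
    (halg' : IsAlgebraic ℚ (α / Real.pi)) :
    ∃ r : ℚ, α / Real.pi = (r : ℝ) := by
  have hb : IsAlgebraic ℚ ((α / Real.pi : ℝ) : ℂ) :=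
    halg'.algebraMap (A := ℂ)
  have hq : IsAlgebraic ℚ (Complex.exp (2 * Real.pi * Complex.I * ((α / Real.pi : ℝ) : ℂ))) := by
    have : Complex.exp (2 * Real.pi * Complex.I * ((α / Real.pi : ℝ) : ℂ)) =
        Complex.exp (Complex.I * α) ^ 2 := by
      rw [← Complex.exp_nat_mul]
      congr 1
      have := Complex.ofReal_ne_zero.2 Real.pi_ne_zero
      push_cast
      field_simp
    rw [this]
    exact halg.pow 2
  obtain ⟨r, hr⟩ := exists_rat_eq_of_isAlgebraic_exp hb hq
  exact ⟨r, by exact_mod_cast hr⟩
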